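/- arXiv:2008.12051 — 7 statements merged into one kernel-verified Lean document; each statement's English description precedes it below -/
import Mathlib

section
/- Let K ≥ 1, let a : Fin K → ℝ, let w : Fin K → ℝ be importances with w k ≥ 0 for all k and ∑_k w k = 1, and let r ∈ (0,1]. Let σ be a permutation of Fin K such that a∘σ is nonincreasing (a (σ 1) ≥ a (σ 2) ≥ … ≥ a (σ K)), set T_0 = 0 and T_j = ∑_{i ≤ j} w (σ i), and define λ_j = f(T_j) − f(T_{j−1}) where f(t) = min(t/r, 1). Then ∑_j λ_j · a (σ j) = max{ (1/r) ∑_k μ_k · a k : μ : Fin K → ℝ, 0 ≤ μ_k ≤ w k for all k, ∑_k μ_k = r }. In particular the left-hand side does not depend on the choice of the sorting permutation σ. -/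
/-- Telescoping over the initial segments of `Fin K`. -/
theorem sum_Iic_sub_Iio (K : ℕ) (F : Finset (Fin K) → ℝ) :
    ∑ j, (F (Finset.Iic j) - F (Finset.Iio j)) = F Finset.univ - F ∅ := by
  let g : ℕ → ℝ := fun n => F (Finset.univ.filter fun i : Fin K => i.val < n)
  have h1 : ∀ j : Fin K, F (Finset.Iic j) - F (Finset.Iio j) = g (j.val + 1) - g j.val := by
    intro j
    have hc : Finset.Iic j = Finset.univ.filter fun i : Fin K => i.val < j.val + 1 := by
      ext i
      simp
    have ho : Finset.Iio j = Finset.univ.filter fun i : Fin K => i.val < j.val := by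
      ext i
      simp
    rw [hc, ho]
  rw [Finset.sum_congr rfl fun j _ => h1 j,
    Fin.sum_univ_eq_sum_range (fun n => g (n + 1) - g n) K, Finset.sum_range_sub]
  simp [g]

/-- A vector that is maximal where `a` exceeds `c` and minimal where it is below `c` maximizes the
pairing with `a` among all vectors with the same total. -/
theorem sum_mul_le_sum_mul_of_pivot {ι : Type*} [Fintype ι] (a μ ν : ι → ℝ) (c : ℝ)
    (hsum : ∑ k, μ k = ∑ k, ν k) (h : ∀ k, 0 ≤ (ν k - μ k) * (a k - c)) :
    ∑ k, μ k * a k ≤ ∑ k, ν k * a k := by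
  have h0 : 0 ≤ ∑ k, (ν k - μ k) * (a k - c) := Finset.sum_nonneg fun k _ => h k
  have h1 : ∑ k, (ν k - μ k) * (a k - c)
      = (∑ k, ν k * a k - ∑ k, μ k * a k) - c * (∑ k, ν k - ∑ k, μ k) := by
    simp only [mul_sub, Finset.mul_sum, ← Finset.sum_sub_distrib]
    exact Finset.sum_congr rfl fun k _ => by ring
  rw [h1, hsum] at h0
  linarith

/-- The r-OWA computed via the weight generating function f(t) = min(t/r, 1) from a sorting
permutation σ equals the maximum of (1/r)·∑ μ_k a_k over {μ : 0 ≤ μ ≤ w, ∑ μ = r}.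
In particular it does not depend on the choice of σ. -/
theorem rOWA_eq_max
    (K : ℕ) (hK : 1 ≤ K) (a w : Fin K → ℝ)
    (hw0 : ∀ k, 0 ≤ w k) (hw1 : ∑ k, w k = 1)
    (r : ℝ) (hr0 : 0 < r) (hr1 : r ≤ 1)
    (σ : Equiv.Perm (Fin K)) (hσ : Antitone (fun i => a (σ i)))
    (f : ℝ → ℝ) (hf : f = fun t => min (t / r) 1)
    (T : Fin K → ℝ) (hT : T = fun j => ∑ i ∈ Finset.Iic j, w (σ i))
    (Tprev : Fin K → ℝ) (hTprev : Tprev = fun j => ∑ i ∈ Finset.Iio j, w (σ i))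
    (lam : Fin K → ℝ) (hlam : lam = fun j => f (T j) - f (Tprev j)) :
    IsGreatest
      {s : ℝ | ∃ μ : Fin K → ℝ, (∀ k, 0 ≤ μ k ∧ μ k ≤ w k) ∧ (∑ k, μ k = r) ∧
        s = (1 / r) * ∑ k, μ k * a k}
      (∑ j, lam j * a (σ j)) := by
  have hT0 : ∀ j, Tprev j + w (σ j) = T j := by
    intro j
    rw [hT, hTprev]
    simp only
    rw [← Finset.Iio_insert, Finset.sum_insert (by simp), add_comm]
  have hTmono : ∀ i j, i < j → T i ≤ Tprev j := by
    intro i j hij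
    rw [hT, hTprev]
    refine Finset.sum_le_sum_of_subset_of_nonneg (fun k hk => ?_) fun k _ _ => hw0 _
    exact Finset.mem_Iio.2 ((Finset.mem_Iic.1 hk).trans_lt hij)
  have hwσ : ∑ j, w (σ j) = 1 := by rw [Equiv.sum_comp σ w, hw1]
  obtain ⟨ν, hν⟩ : ∃ ν : Fin K → ℝ, ν = fun j => min (T j) r - min (Tprev j) r := ⟨_, rfl⟩
  have hlamν : ∀ j, lam j = 1 / r * ν j := by
    intro j
    have key : ∀ t : ℝ, min (t / r) 1 = 1 / r * min t r := by
      intro t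
      rw [mul_min_of_nonneg _ _ (by positivity)]
      congr 1 <;> field_simp
    simp only [hlam, hf, hν, key, mul_sub]
  have hobj : ∑ j, lam j * a (σ j) = 1 / r * ∑ j, ν j * a (σ j) := by
    rw [Finset.mul_sum]
    exact Finset.sum_congr rfl fun j _ => by rw [hlamν, mul_assoc]
  have hνsum : ∑ j, ν j = r := by
    have h := sum_Iic_sub_Iio K fun s => min (∑ i ∈ s, w (σ i)) r
    simp only [hwσ, Finset.sum_empty, min_eq_right hr1, min_eq_left hr0.le, sub_zero] at h
    rw [hν, hT, hTprev]
    exact h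
  have hνb : ∀ j, 0 ≤ ν j ∧ ν j ≤ w (σ j) := by
    intro j
    have h1 := hT0 j
    have h2 := hw0 (σ j)
    rw [hν]
    simp only
    constructor <;> rcases min_cases (T j) r with h | h <;>
      rcases min_cases (Tprev j) r with h' | h' <;> linarith
  rw [hobj]
  constructor
  · refine ⟨fun k => ν (σ.symm k), fun k => ?_, ?_, ?_⟩
    · simpa using hνb (σ.symm k)
    · rw [Equiv.sum_comp σ.symm ν, hνsum]
    · rw [← Equiv.sum_comp σ fun k => ν (σ.symm k) * a k]
      simp
  · rintro s ⟨μ, hμ, hμsum, rfl⟩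
    refine mul_le_mul_of_nonneg_left ?_ (by positivity)
    rw [← Equiv.sum_comp σ fun k => μ k * a k]
    obtain ⟨p, hp, hpmin⟩ : ∃ p, r ≤ T p ∧ ∀ j < p, T j < r := by
      have hne : ∃ j, r ≤ T j := by
        refine ⟨⟨K - 1, by omega⟩, ?_⟩
        have hu : Finset.Iic (⟨K - 1, by omega⟩ : Fin K) = Finset.univ := by
          ext i
          simp [Fin.le_def]
          omega
        simp only [hT, hu, hwσ, hr1]
      obtain ⟨p, hp, hmin⟩ := WellFounded.has_min (wellFounded_lt (α := Fin K)) {j | r ≤ T j} hne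
      exact ⟨p, hp, fun j hj => lt_of_not_ge fun h => hmin j h hj⟩
    refine sum_mul_le_sum_mul_of_pivot (fun j => a (σ j)) (fun j => μ (σ j)) ν (a (σ p)) ?_ ?_
    · rw [Equiv.sum_comp σ μ, hμsum, hνsum]
    · intro j
      have hj := hμ (σ j)
      rcases lt_trichotomy j p with h | h | h
      · have hTj := hpmin j h
        have hνj : ν j = w (σ j) := by
          have h1 := hT0 j
          have h2 := hw0 (σ j)
          simp only [hν]
          rw [min_eq_left hTj.le, min_eq_left (by linarith)]
          linarith
        exact mul_nonneg (by linarith) (sub_nonneg.2 (hσ h.le))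
      · simp [h]
      · have hTj := hp.trans (hTmono p j h)
        have hνj : ν j = 0 := by
          have h1 := hT0 j
          have h2 := hw0 (σ j)
          simp only [hν]
          rw [min_eq_right hTj, min_eq_right (by linarith), sub_self]
        exact mul_nonneg_of_nonpos_of_nonpos (by linarith) (sub_nonpos.2 (hσ h.le))
end

section
/- Let J ≥ 1, let a : Fin J → ℝ, let π : Fin J → ℝ be probabilities with π j ≥ 0 for all j and ∑_j π j = 1, and let β ∈ (0,1]. Let σ be a permutation of Fin J with a∘σ nonincreasing, and let ĵ be the least index with ∑_{i ≤ ĵ} π (σ i) ≥ β. Then (1/β) · ( ∑_{i < ĵ} π (σ i) · a (σ i) + (β − ∑_{i < ĵ} π (σ i)) · a (σ ĵ) ) = max{ (1/β) ∑_j u_j · a j : u : Fin J → ℝ, 0 ≤ u_j ≤ π j for all j, ∑_j u_j = β }. That is, the β-average (the probability-weighted average of the worst values of a with accumulated probability exactly β) equals the optimal value of this linear program. -/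
/-- The weights that fill the capacities `p` below `k`, put `c` at `k`, and vanish above `k`. -/
noncomputable def greedyWeight {J : ℕ} (p : Fin J → ℝ) (k : Fin J) (c : ℝ) (i : Fin J) : ℝ :=
  if i < k then p i else if i = k then c else 0

theorem sum_greedyWeight_mul {J : ℕ} (p f : Fin J → ℝ) (k : Fin J) (c : ℝ) :
    ∑ i, greedyWeight p k c i * f i = ∑ i ∈ Finset.Iio k, p i * f i + c * f k := by
  have h : ∀ i, greedyWeight p k c i * f i =
      (if i < k then p i * f i else 0) + (if i = k then c * f i else 0) := by
    intro i
    unfold greedyWeight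
    split_ifs with h₁ h₂
    · exact absurd h₂ h₁.ne
    all_goals simp
  rw [Finset.sum_congr rfl fun i _ => h i, Finset.sum_add_distrib, ← Finset.sum_filter]
  congr 1
  · exact Finset.sum_congr (by ext; simp) fun _ _ => rfl
  · simp

theorem sum_greedyWeight {J : ℕ} (p : Fin J → ℝ) (k : Fin J) (c : ℝ) :
    ∑ i, greedyWeight p k c i = ∑ i ∈ Finset.Iio k, p i + c := by
  simpa using sum_greedyWeight_mul p 1 k c

/-- Among weights bounded by `p` with a given total, the greedy ones maximize the weighted sum of
an antitone sequence. -/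
theorem sum_mul_le_sum_greedyWeight_mul {J : ℕ} {p v b : Fin J → ℝ} {k : Fin J} {c : ℝ}
    (hb : Antitone b) (hv0 : ∀ i, 0 ≤ v i) (hvp : ∀ i, v i ≤ p i)
    (hsum : ∑ i, v i = ∑ i, greedyWeight p k c i) :
    ∑ i, v i * b i ≤ ∑ i, greedyWeight p k c i * b i := by
  have h : 0 ≤ ∑ i, (greedyWeight p k c i - v i) * (b i - b k) := by
    refine Finset.sum_nonneg fun i _ => ?_
    unfold greedyWeight
    split_ifs with h₁ h₂
    · exact mul_nonneg (sub_nonneg.2 (hvp i)) (sub_nonneg.2 (hb h₁.le))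
    · simp [h₂]
    · exact mul_nonneg_of_nonpos_of_nonpos (by linarith [hv0 i])
        (sub_nonpos.2 (hb (not_lt.1 h₁)))
  simp only [mul_sub, sub_mul, Finset.sum_sub_distrib, ← Finset.sum_mul] at h
  rw [hsum] at h
  linarith

/-- Strictly before the least index whose partial sum reaches `β > 0`, the partial sum is at most
`β`. -/
theorem sum_Iio_le_of_isLeast {J : ℕ} {p : Fin J → ℝ} {β : ℝ} (hβ : 0 < β) {k : Fin J}
    (hk : IsLeast {j : Fin J | β ≤ ∑ i ∈ Finset.Iic j, p i} k) :
    ∑ i ∈ Finset.Iio k, p i ≤ β := by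
  by_contra! h
  rcases Nat.eq_zero_or_pos k.val with h0 | hpos
  · have : Finset.Iio k = ∅ := by
      ext i
      simp [Fin.lt_def, h0]
    rw [this, Finset.sum_empty] at h
    exact h.not_gt hβ
  · let m : Fin J := ⟨k - 1, by omega⟩
    have hm : Finset.Iic m = Finset.Iio k := by
      ext i
      simp only [Finset.mem_Iic, Finset.mem_Iio, Fin.le_def, Fin.lt_def, m]
      omega
    have hle : k ≤ m := hk.2 (by simpa only [Set.mem_ofPred_eq, hm] using h.le)
    rw [Fin.le_def] at hle
    simp only [m] at hle
    omega

/-- The β-average (probability-weighted average of the worst values of a with accumulated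
probability exactly β) equals the maximum of (1/β)·∑ u_j a_j over {u : 0 ≤ u ≤ π, ∑ u = β}. -/
theorem betaAverage_eq_max
    (J : ℕ) (hJ : 1 ≤ J) (a pr : Fin J → ℝ)
    (hpr0 : ∀ j, 0 ≤ pr j) (hpr1 : ∑ j, pr j = 1)
    (β : ℝ) (hβ0 : 0 < β) (hβ1 : β ≤ 1)
    (σ : Equiv.Perm (Fin J)) (hσ : Antitone (fun i => a (σ i)))
    (jhat : Fin J)
    (hjhat : IsLeast {j : Fin J | β ≤ ∑ i ∈ Finset.Iic j, pr (σ i)} jhat) :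
    IsGreatest
      {s : ℝ | ∃ u : Fin J → ℝ, (∀ j, 0 ≤ u j ∧ u j ≤ pr j) ∧ (∑ j, u j = β) ∧
        s = (1 / β) * ∑ j, u j * a j}
      ((1 / β) * ((∑ i ∈ Finset.Iio jhat, pr (σ i) * a (σ i))
        + (β - ∑ i ∈ Finset.Iio jhat, pr (σ i)) * a (σ jhat))) := by
  have hS := sum_Iio_le_of_isLeast hβ0 hjhat
  have hS' : β ≤ ∑ i ∈ Finset.Iio jhat, pr (σ i) + pr (σ jhat) := by
    have h : β ≤ ∑ i ∈ Finset.Iic jhat, pr (σ i) := hjhat.1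
    rwa [← Finset.Iio_insert, Finset.sum_insert (by simp), add_comm] at h
  rw [← sum_greedyWeight_mul (fun i => pr (σ i)) (fun i => a (σ i))]
  set c := β - ∑ i ∈ Finset.Iio jhat, pr (σ i) with hc
  have hw : ∑ i, greedyWeight (fun i => pr (σ i)) jhat c i = β := by
    rw [sum_greedyWeight, hc]
    ring
  constructor
  · refine ⟨fun j => greedyWeight (fun i => pr (σ i)) jhat c (σ.symm j), fun j => ?_, ?_, ?_⟩
    · obtain ⟨i, rfl⟩ := σ.surjective j
      simp only [Equiv.symm_apply_apply, greedyWeight]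
      split_ifs with h₁ h₂
      · exact ⟨hpr0 _, le_rfl⟩
      · subst h₂
        exact ⟨by linarith, by linarith⟩
      · exact ⟨le_rfl, hpr0 _⟩
    · rw [← Equiv.sum_comp σ]
      simpa using hw
    · rw [← Equiv.sum_comp σ (fun j => greedyWeight _ jhat c (σ.symm j) * a j)]
      simp
  · rintro s ⟨u, hu, hsum, rfl⟩
    rw [← Equiv.sum_comp σ] at hsum
    rw [← Equiv.sum_comp σ (fun j => u j * a j)]
    exact mul_le_mul_of_nonneg_left
      (sum_mul_le_sum_greedyWeight_mul hσ (fun i => (hu _).1) (fun i => (hu _).2)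
        (hsum.trans hw.symm)) (by positivity)
end

section
/- Let J ≥ 1, let a : Fin J → ℝ, let π : Fin J → ℝ with π j ≥ 0 for all j and ∑_j π j = 1, and let β ∈ (0,1]. Then max{ (1/β) ∑_j u_j · a j : u : Fin J → ℝ, 0 ≤ u_j ≤ π j for all j, ∑_j u_j = β } = inf{ z + ∑_j (π j / β) · y_j : z ∈ ℝ, y : Fin J → ℝ, y_j ≥ 0 for all j, z + y_j ≥ a j for all j }, and the infimum on the right is attained (e.g. at z = a_(ĵ) in the notation of the sorted vector). In other words, strong LP duality holds between this primal linear program defining the β-average and its dual. -/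
/-- The values of a finite weighted family have an upper `β`-quantile. -/
theorem exists_upper_quantile {ι : Type*} [Fintype ι] [Nonempty ι] (a w : ι → ℝ) {β : ℝ}
    (hβ0 : 0 ≤ β) (hβ : β ≤ ∑ j, w j) :
    ∃ z, ∑ j with z < a j, w j ≤ β ∧ β ≤ ∑ j with z ≤ a j, w j := by
  classical
  let S : Finset ι := {k | ∑ j with a k < a j, w j ≤ β}
  have hS : S.Nonempty := by
    obtain ⟨m, hm⟩ := Finite.exists_max a
    refine ⟨m, ?_⟩
    simpa [S, Finset.filter_false_of_mem fun j _ => not_lt.2 (hm j)] using hβ0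
  obtain ⟨k, hkS, hk⟩ := S.exists_min_image a hS
  refine ⟨a k, by simpa [S] using hkS, ?_⟩
  by_cases hT : (Finset.univ.filter fun j => a j < a k).Nonempty
  · obtain ⟨m, hmT, hm⟩ := Finset.exists_max_image _ a hT
    have hmk : a m < a k := by simpa using hmT
    have hβm : β < ∑ j with a m < a j, w j := by
      by_contra! h
      exact absurd (hk m (by simpa [S] using h)) (not_le.2 hmk)
    have heq : (Finset.univ.filter fun j => a m < a j) =
        Finset.univ.filter fun j => a k ≤ a j := by
      ext j
      simp only [Finset.mem_filter, Finset.mem_univ, true_and] at hm ⊢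
      refine ⟨fun h => ?_, hmk.trans_le⟩
      by_contra! hj
      exact absurd (hm j hj) (not_le.2 h)
    exact heq ▸ hβm.le
  · have hle : ∀ j, a k ≤ a j := by
      intro j
      by_contra! h
      exact hT ⟨j, by simpa using h⟩
    simpa [hle] using hβ

/-- A threshold `z` together with a feasible primal point that is complementary to the dual
point `y j = max (a j - z) 0`. -/
theorem exists_threshold_weights {ι : Type*} [Fintype ι] [Nonempty ι] (a w : ι → ℝ) {β : ℝ}
    (hw : ∀ j, 0 ≤ w j) (hβ0 : 0 ≤ β) (hβ : β ≤ ∑ j, w j) :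
    ∃ (z : ℝ) (u : ι → ℝ), (∀ j, 0 ≤ u j ∧ u j ≤ w j) ∧ ∑ j, u j = β ∧
      ∀ j, u j * (a j - z) = w j * max (a j - z) 0 := by
  classical
  obtain ⟨z, hlo, hhi⟩ := exists_upper_quantile a w hβ0 hβ
  obtain ⟨c, d, hc, hd, hcd, hβcd⟩ : β ∈ segment ℝ (∑ j with z < a j, w j)
      (∑ j with z ≤ a j, w j) := by
    rw [segment_eq_Icc (hlo.trans hhi)]
    exact ⟨hlo, hhi⟩
  refine ⟨z, fun j => c * (if z < a j then w j else 0) + d * (if z ≤ a j then w j else 0),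
    fun j => ?_, ?_, fun j => ?_⟩
  · have hwj := hw j
    rcases lt_trichotomy z (a j) with h | h | h
    · simp only [h, h.le, if_true, ← add_mul, hcd, one_mul]
      exact ⟨hwj, le_rfl⟩
    · simp only [h, lt_irrefl, le_refl, if_true, if_false, mul_zero, zero_add]
      exact ⟨mul_nonneg hd hwj, mul_le_of_le_one_left hwj (by linarith)⟩
    · simpa [h.not_ge, h.not_gt] using hwj
  · rw [Finset.sum_add_distrib, ← Finset.mul_sum, ← Finset.mul_sum, ← Finset.sum_filter,
      ← Finset.sum_filter]
    exact hβcd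
  · rcases lt_trichotomy z (a j) with h | h | h
    · simp only [h, h.le, if_true, ← add_mul, hcd, one_mul, max_eq_left (sub_nonneg.2 h.le)]
    · simp [h]
    · simp [h.not_ge, h.not_gt, max_eq_right (sub_nonpos.2 h.le)]

/-- Strong LP duality for the β-average: the maximum of the primal linear program equals the
infimum of its dual, and the dual infimum is attained. -/
theorem betaAverage_strong_duality
    (J : ℕ) (hJ : 1 ≤ J) (a pr : Fin J → ℝ)
    (hpr0 : ∀ j, 0 ≤ pr j) (hpr1 : ∑ j, pr j = 1)
    (β : ℝ) (hβ0 : 0 < β) (hβ1 : β ≤ 1)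
    (P : Set ℝ)
    (hP : P = {s : ℝ | ∃ u : Fin J → ℝ, (∀ j, 0 ≤ u j ∧ u j ≤ pr j) ∧ (∑ j, u j = β) ∧
      s = (1 / β) * ∑ j, u j * a j})
    (D : Set ℝ)
    (hD : D = {t : ℝ | ∃ (z : ℝ) (y : Fin J → ℝ), (∀ j, 0 ≤ y j) ∧ (∀ j, a j ≤ z + y j) ∧
      t = z + ∑ j, (pr j / β) * y j}) :
    sSup P = sInf D ∧ sInf D ∈ D := by
  subst hP hD
  have : Nonempty (Fin J) := ⟨⟨0, hJ⟩⟩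
  have weak : ∀ s ∈ {s : ℝ | ∃ u : Fin J → ℝ, (∀ j, 0 ≤ u j ∧ u j ≤ pr j) ∧ (∑ j, u j = β) ∧
      s = (1 / β) * ∑ j, u j * a j}, ∀ t ∈ {t : ℝ | ∃ (z : ℝ) (y : Fin J → ℝ),
      (∀ j, 0 ≤ y j) ∧ (∀ j, a j ≤ z + y j) ∧ t = z + ∑ j, (pr j / β) * y j}, s ≤ t := by
    rintro _ ⟨u, hu, hsum, rfl⟩ _ ⟨z, y, hy, hay, rfl⟩
    have hle : ∑ j, u j * a j ≤ ∑ j, (u j * z + pr j * y j) :=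
      Finset.sum_le_sum fun j _ => by
        have h1 := mul_le_mul_of_nonneg_left (hay j) (hu j).1
        have h2 := mul_le_mul_of_nonneg_right (hu j).2 (hy j)
        linarith
    rw [Finset.sum_add_distrib, ← Finset.sum_mul, hsum] at hle
    simp only [div_mul_eq_mul_div, ← Finset.sum_div]
    rw [one_mul, div_le_iff₀ hβ0, add_mul, div_mul_cancel₀ _ hβ0.ne']
    linarith
  obtain ⟨z, u, hu, hsum, hcompl⟩ :=
    exists_threshold_weights a pr hpr0 hβ0.le (hβ1.trans_eq hpr1.symm)
  have hval : (1 / β) * ∑ j, u j * a j = z + ∑ j, (pr j / β) * max (a j - z) 0 := by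
    have hsplit : ∑ j, u j * a j = β * z + ∑ j, pr j * max (a j - z) 0 := by
      rw [← hsum, Finset.sum_mul, ← Finset.sum_add_distrib]
      exact Finset.sum_congr rfl fun j _ => by rw [← hcompl j]; ring
    simp only [div_mul_eq_mul_div, ← Finset.sum_div]
    rw [hsplit]
    field_simp
  have hprimal : (1 / β) * ∑ j, u j * a j ∈ {s : ℝ | ∃ u : Fin J → ℝ,
      (∀ j, 0 ≤ u j ∧ u j ≤ pr j) ∧ (∑ j, u j = β) ∧ s = (1 / β) * ∑ j, u j * a j} :=
    ⟨u, hu, hsum, rfl⟩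
  have hdual : (1 / β) * ∑ j, u j * a j ∈ {t : ℝ | ∃ (z : ℝ) (y : Fin J → ℝ),
      (∀ j, 0 ≤ y j) ∧ (∀ j, a j ≤ z + y j) ∧ t = z + ∑ j, (pr j / β) * y j} :=
    ⟨z, fun j => max (a j - z) 0, fun j => le_max_right _ _,
      fun j => by linarith [le_max_left (a j - z) 0], hval⟩
  have hgreatest := IsGreatest.csSup_eq ⟨hprimal, fun s hs => weak s hs _ hdual⟩
  have hleast := IsLeast.csInf_eq ⟨hdual, fun t ht => weak _ hprimal t ht⟩
  exact ⟨hgreatest.trans hleast.symm, by rw [hleast]; exact hdual⟩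
end

section
/- Let K ≥ 1, let a : Fin K → ℝ, let w : Fin K → ℝ with w k ≥ 0 for all k and ∑_k w k = 1, and let r ∈ (0,1]. Then max{ (1/r) ∑_k λ_k · a k : λ : Fin K → ℝ, 0 ≤ λ_k ≤ w k for all k, ∑_k λ_k = r } = inf{ z + ∑_k (w k / r) · v_k : z ∈ ℝ, v : Fin K → ℝ, v_k ≥ 0 for all k, z + v_k ≥ a k for all k }, and the infimum on the right is attained. In other words, strong LP duality holds between the primal linear program defining the r-OWA and its dual. -/
/-- A weighted quantile: some value `a j` has upper weight at least `r` and strict upper weight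
at most `r`. -/
theorem exists_weighted_quantile {ι : Type*} [Fintype ι] [Nonempty ι] (a w : ι → ℝ) {r : ℝ}
    (hr0 : 0 ≤ r) (hr1 : r ≤ ∑ k, w k) :
    ∃ j, ∑ k with a j < a k, w k ≤ r ∧ r ≤ ∑ k with a j ≤ a k, w k := by
  classical
  let S : Finset ι := {j | r ≤ ∑ k with a j ≤ a k, w k}
  have hS : S.Nonempty := by
    obtain ⟨i, hi⟩ := Finite.exists_min a
    exact ⟨i, by simpa [S, hi] using hr1⟩
  obtain ⟨j, hjS, hj⟩ := S.exists_max_image a hS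
  refine ⟨j, ?_, (Finset.mem_filter.mp hjS).2⟩
  rcases (Finset.univ.filter fun k => a j < a k).eq_empty_or_nonempty with hT | hT
  · simpa [hT] using hr0
  · obtain ⟨i, hiT, hi⟩ := Finset.exists_min_image _ a hT
    have hji : a j < a i := (Finset.mem_filter.mp hiT).2
    have hfilter : (Finset.univ.filter fun k => a j < a k) =
        Finset.univ.filter fun k => a i ≤ a k := by
      ext k
      simp only [Finset.mem_filter, Finset.mem_univ, true_and]
      exact ⟨fun hk => hi k (by simpa using hk), fun hk => hji.trans_le hk⟩
    rw [hfilter]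
    by_contra! h
    exact (hj i (Finset.mem_filter.mpr ⟨Finset.mem_univ i, h.le⟩)).not_gt hji

/-- Weak duality: an allocation bounded by `w` of total mass `r` is dominated by any dual
feasible point. -/
theorem sum_mul_le_of_dual_feasible {ι : Type*} [Fintype ι] {a w lam v : ι → ℝ} {r z : ℝ}
    (hlam : ∀ k, 0 ≤ lam k ∧ lam k ≤ w k) (hsum : ∑ k, lam k = r)
    (hv : ∀ k, 0 ≤ v k) (ha : ∀ k, a k ≤ z + v k) :
    ∑ k, lam k * a k ≤ r * z + ∑ k, w k * v k := by
  rw [← hsum, Finset.sum_mul, ← Finset.sum_add_distrib]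
  refine Finset.sum_le_sum fun k _ => ?_
  have h₁ := mul_le_mul_of_nonneg_left (ha k) (hlam k).1
  have h₂ := mul_le_mul_of_nonneg_right (hlam k).2 (hv k)
  linarith

/-- A threshold `z` and a feasible allocation that satisfy complementary slackness. -/
theorem exists_complementary_allocation {ι : Type*} [Fintype ι] [Nonempty ι] (a w : ι → ℝ)
    (hw : ∀ k, 0 ≤ w k) {r : ℝ} (hr0 : 0 ≤ r) (hr1 : r ≤ ∑ k, w k) :
    ∃ (z : ℝ) (lam : ι → ℝ), (∀ k, 0 ≤ lam k ∧ lam k ≤ w k) ∧ ∑ k, lam k = r ∧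
      ∀ k, lam k * (a k - z) = w k * max (a k - z) 0 := by
  classical
  obtain ⟨j, hlt, hle⟩ := exists_weighted_quantile a w hr0 hr1
  set A := ∑ k with a j < a k, w k with hA
  set B := ∑ k with a j = a k, w k with hB
  have hAB : ∑ k with a j ≤ a k, w k = A + B := by
    simp only [hA, hB, Finset.sum_filter, ← Finset.sum_add_distrib]
    refine Finset.sum_congr rfl fun k _ => ?_
    rcases lt_trichotomy (a j) (a k) with h | h | h
    · simp [h, h.le, h.ne]
    · simp [h]
    · simp [h.not_ge, h.not_gt, h.ne']
  rw [hAB] at hle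
  have hB0 : 0 ≤ B := Finset.sum_nonneg fun k _ => hw k
  obtain ⟨θ, hθ0, hθ1, hθ⟩ : ∃ θ : ℝ, 0 ≤ θ ∧ θ ≤ 1 ∧ A + θ * B = r := by
    rcases hB0.eq_or_lt with h | h
    · exact ⟨0, le_rfl, zero_le_one, by linarith⟩
    · refine ⟨(r - A) / B, div_nonneg (by linarith) hB0, (div_le_one h).2 (by linarith), ?_⟩
      rw [div_mul_cancel₀ _ h.ne']
      ring
  refine ⟨a j, fun k => (if a j < a k then w k else 0) + θ * (if a j = a k then w k else 0),
    fun k => ?_, ?_, fun k => ?_⟩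
  · have h₀ := mul_nonneg hθ0 (hw k)
    have h₁ := mul_le_of_le_one_left (hw k) hθ1
    rcases lt_trichotomy (a j) (a k) with h | h | h
    · simp [h, h.ne, hw k]
    · simp [h, h₀, h₁]
    · simp [h.not_gt, h.ne', hw k]
  · rw [Finset.sum_add_distrib, ← Finset.mul_sum, ← Finset.sum_filter, ← Finset.sum_filter, hθ]
  · rcases lt_trichotomy (a j) (a k) with h | h | h
    · simp [h, h.ne, max_eq_left (sub_nonneg.2 h.le)]
    · simp [h]
    · simp [h.not_gt, h.ne', max_eq_right (sub_nonpos.2 h.le)]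

/-- Strong LP duality for the r-OWA: the maximum of the primal linear program equals the
infimum of its dual, and the dual infimum is attained. -/
theorem rOWA_strong_duality
    (K : ℕ) (hK : 1 ≤ K) (a w : Fin K → ℝ)
    (hw0 : ∀ k, 0 ≤ w k) (hw1 : ∑ k, w k = 1)
    (r : ℝ) (hr0 : 0 < r) (hr1 : r ≤ 1)
    (P : Set ℝ)
    (hP : P = {s : ℝ | ∃ lam : Fin K → ℝ, (∀ k, 0 ≤ lam k ∧ lam k ≤ w k) ∧
      (∑ k, lam k = r) ∧ s = (1 / r) * ∑ k, lam k * a k})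
    (D : Set ℝ)
    (hD : D = {t : ℝ | ∃ (z : ℝ) (v : Fin K → ℝ), (∀ k, 0 ≤ v k) ∧ (∀ k, a k ≤ z + v k) ∧
      t = z + ∑ k, (w k / r) * v k}) :
    sSup P = sInf D ∧ sInf D ∈ D := by
  have : Nonempty (Fin K) := ⟨⟨0, hK⟩⟩
  have hdual (z : ℝ) (v : Fin K → ℝ) :
      z + ∑ k, (w k / r) * v k = (1 / r) * (r * z + ∑ k, w k * v k) := by
    rw [mul_add, ← mul_assoc, one_div_mul_cancel hr0.ne', one_mul, Finset.mul_sum]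
    exact congrArg _ (Finset.sum_congr rfl fun k _ => by ring)
  have hweak : ∀ s ∈ P, ∀ t ∈ D, s ≤ t := by
    subst hP hD
    rintro _ ⟨lam, hlam, hsum, rfl⟩ _ ⟨z, v, hv, ha, rfl⟩
    rw [hdual]
    exact mul_le_mul_of_nonneg_left (sum_mul_le_of_dual_feasible hlam hsum hv ha)
      (one_div_pos.2 hr0).le
  obtain ⟨x, hxP, hxD⟩ : ∃ x, x ∈ P ∧ x ∈ D := by
    subst hP hD
    obtain ⟨z, lam, hlam, hsum, hslack⟩ :=
      exists_complementary_allocation a w hw0 hr0.le (hr1.trans_eq hw1.symm)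
    refine ⟨_, ⟨lam, hlam, hsum, rfl⟩, z, fun k => max (a k - z) 0, fun k => le_max_right _ _,
      fun k => by linarith [le_max_left (a k - z) 0], ?_⟩
    rw [hdual, ← hsum, Finset.sum_mul, ← Finset.sum_add_distrib]
    exact congrArg _ (Finset.sum_congr rfl fun k _ => by linarith [hslack k])
  have hmax : IsGreatest P x := ⟨hxP, fun s hs => hweak s hs x hxD⟩
  have hmin : IsLeast D x := ⟨hxD, fun t ht => hweak x hxP t ht⟩
  rw [hmax.csSup_eq, hmin.csInf_eq]
  exact ⟨rfl, hxD⟩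
end

section
/- Let X be a nonempty set, K ≥ 1, let g : X → (Fin K → ℝ) assign to each point the vector of its K objective values (to be minimized), let w : Fin K → ℝ with w k ≥ 0 for all k and ∑_k w k = 1, let r ∈ (0,1], and define h(x) = max{ (1/r) ∑_k λ_k · g(x) k : 0 ≤ λ_k ≤ w k for all k, ∑_k λ_k = r }. If x* ∈ X satisfies h(x*) ≤ h(x) for all x ∈ X (i.e. x* is a minimizer of h), then x* is weakly efficient for the multiobjective problem min_{x ∈ X} (g(x) 1, …, g(x) K): there is no x ∈ X with g(x) k < g(x*) k for all k. -/
/-- The values `(1 / r) ∑ λ_k a_k` over which the r-OWA of `a` is the maximum. -/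
def rOWAValues {ι : Type*} [Fintype ι] (w : ι → ℝ) (r : ℝ) (a : ι → ℝ) : Set ℝ :=
  {s : ℝ | ∃ lam : ι → ℝ, (∀ k, 0 ≤ lam k ∧ lam k ≤ w k) ∧ (∑ k, lam k = r) ∧
    s = (1 / r) * ∑ k, lam k * a k}

section rOWAValues

variable {ι : Type*} [Fintype ι] {w : ι → ℝ} {r : ℝ}

theorem rOWAValues_nonempty (hw0 : ∀ k, 0 ≤ w k) (hw1 : ∑ k, w k = 1)
    (hr0 : 0 ≤ r) (hr1 : r ≤ 1) (a : ι → ℝ) : (rOWAValues w r a).Nonempty :=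
  ⟨_, fun k => r * w k,
    fun k => ⟨mul_nonneg hr0 (hw0 k), mul_le_of_le_one_left (hw0 k) hr1⟩,
    by rw [← Finset.mul_sum, hw1, mul_one], rfl⟩

theorem rOWAValues_bddAbove (hr0 : 0 ≤ r) (a : ι → ℝ) : BddAbove (rOWAValues w r a) := by
  refine ⟨(1 / r) * ∑ k, w k * |a k|, ?_⟩
  rintro s ⟨lam, hlam, -, rfl⟩
  refine mul_le_mul_of_nonneg_left (Finset.sum_le_sum fun k _ => ?_) (by positivity)
  exact (mul_le_mul_of_nonneg_left (le_abs_self _) (hlam k).1).trans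
    (mul_le_mul_of_nonneg_right (hlam k).2 (abs_nonneg _))

/-- The r-OWA grows by at least `δ` when every component grows by at least `δ`. -/
theorem sSup_rOWAValues_add_le (hw0 : ∀ k, 0 ≤ w k) (hw1 : ∑ k, w k = 1)
    (hr0 : 0 < r) (hr1 : r ≤ 1) {a b : ι → ℝ} {δ : ℝ} (hab : ∀ k, a k + δ ≤ b k) :
    sSup (rOWAValues w r a) + δ ≤ sSup (rOWAValues w r b) := by
  rw [← le_sub_iff_add_le]
  refine csSup_le (rOWAValues_nonempty hw0 hw1 hr0.le hr1 a) ?_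
  rintro s ⟨lam, hlam, hsum, rfl⟩
  rw [le_sub_iff_add_le]
  refine le_trans ?_ (le_csSup (rOWAValues_bddAbove hr0.le b) ⟨lam, hlam, hsum, rfl⟩)
  calc (1 / r) * ∑ k, lam k * a k + δ = (1 / r) * ∑ k, lam k * (a k + δ) := by
        simp only [mul_add, Finset.sum_add_distrib, ← Finset.sum_mul, hsum]
        field_simp
    _ ≤ (1 / r) * ∑ k, lam k * b k :=
        mul_le_mul_of_nonneg_left
          (Finset.sum_le_sum fun k _ => mul_le_mul_of_nonneg_left (hab k) (hlam k).1)
          (by positivity)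

/-- The r-OWA is strictly monotone for componentwise strict inequality. -/
theorem sSup_rOWAValues_lt [Nonempty ι] (hw0 : ∀ k, 0 ≤ w k) (hw1 : ∑ k, w k = 1)
    (hr0 : 0 < r) (hr1 : r ≤ 1) {a b : ι → ℝ} (hab : ∀ k, a k < b k) :
    sSup (rOWAValues w r a) < sSup (rOWAValues w r b) := by
  obtain ⟨j, hj⟩ := Finite.exists_min fun k => b k - a k
  have hle : sSup (rOWAValues w r a) + (b j - a j) ≤ sSup (rOWAValues w r b) :=
    sSup_rOWAValues_add_le hw0 hw1 hr0 hr1 fun k => by linarith [hj k]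
  linarith [hab j]

end rOWAValues

/-- A minimizer of the r-OWA scalarization h(x) = O_r(g(x)) is weakly efficient for the
multiobjective problem: no feasible point strictly improves all objectives. -/
theorem rOWA_minimizer_weakly_efficient
    {X : Type*} [Nonempty X]
    (K : ℕ) (hK : 1 ≤ K) (g : X → Fin K → ℝ)
    (w : Fin K → ℝ) (hw0 : ∀ k, 0 ≤ w k) (hw1 : ∑ k, w k = 1)
    (r : ℝ) (hr0 : 0 < r) (hr1 : r ≤ 1)
    (h : X → ℝ)
    (hh : h = fun x => sSup {s : ℝ | ∃ lam : Fin K → ℝ,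
      (∀ k, 0 ≤ lam k ∧ lam k ≤ w k) ∧ (∑ k, lam k = r) ∧
      s = (1 / r) * ∑ k, lam k * g x k})
    (xstar : X) (hmin : ∀ x : X, h xstar ≤ h x) :
    ¬ ∃ x : X, ∀ k, g x k < g xstar k := by
  rintro ⟨x, hx⟩
  have : NeZero K := ⟨by omega⟩
  subst hh
  exact (hmin x).not_gt (sSup_rOWAValues_lt hw0 hw1 hr0 hr1 hx)
end

section
/- A minimizer of the r-OWA scalarization need not be efficient: take K = 3, equal importances w k = 1/3 for all k, r = 2/3, a two-element set X = {x₁, x₂}, and g : X → (Fin 3 → ℝ) with g(x₁) = (0.8, 0.4, 0.65) and g(x₂) = (0.8, 0.45, 0.65). Then, with h(x) = max{ (1/r) ∑_k λ_k · g(x) k : 0 ≤ λ_k ≤ w k, ∑_k λ_k = r }, one has h(x₁) = h(x₂) = 0.725, so x₂ is a minimizer of h over X; yet x₂ is not efficient, since g(x₁) k ≤ g(x₂) k for all k with strict inequality in the second coordinate. -/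
/-- With equal importances `1 / 3` and `r = 2 / 3`, the `r`-OWA of three values whose smallest one
is `a 1` is the average of the other two, and the maximum is attained. -/
theorem isGreatest_rOWA_third_two_thirds (a : Fin 3 → ℝ) (h0 : a 1 ≤ a 0) (h2 : a 1 ≤ a 2) :
    IsGreatest {s : ℝ | ∃ lam : Fin 3 → ℝ,
      (∀ k, 0 ≤ lam k ∧ lam k ≤ 1 / 3) ∧ (∑ k, lam k = 2 / 3) ∧
      s = (1 / (2 / 3)) * ∑ k, lam k * a k} ((a 0 + a 2) / 2) := by
  constructor
  · refine ⟨![1 / 3, 0, 1 / 3], fun k => ?_, ?_, ?_⟩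
    · fin_cases k <;> norm_num
    · simp [Fin.sum_univ_three]
      norm_num
    · simp [Fin.sum_univ_three]
      ring
  · rintro s ⟨l, hl, hsum, rfl⟩
    simp only [Fin.sum_univ_three] at hsum ⊢
    have e : l 1 = 2 / 3 - l 0 - l 2 := by linarith
    rw [e]
    have i0 := mul_nonneg (sub_nonneg.2 (hl 0).2) (sub_nonneg.2 h0)
    have i2 := mul_nonneg (sub_nonneg.2 (hl 2).2) (sub_nonneg.2 h2)
    linarith

/-- A minimizer of the r-OWA scalarization need not be efficient: with K = 3, equal importances
1/3, r = 2/3, and two alternatives g 0 = (0.8, 0.4, 0.65), g 1 = (0.8, 0.45, 0.65), both have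
h = 0.725, so alternative 1 is a minimizer of h, yet it is dominated by alternative 0. -/
theorem rOWA_minimizer_not_efficient_example
    (w : Fin 3 → ℝ) (hw : w = fun _ => 1 / 3)
    (r : ℝ) (hr : r = 2 / 3)
    (g : Fin 2 → Fin 3 → ℝ)
    (hg0 : g 0 = ![0.8, 0.4, 0.65])
    (hg1 : g 1 = ![0.8, 0.45, 0.65])
    (h : Fin 2 → ℝ)
    (hh : h = fun x => sSup {s : ℝ | ∃ lam : Fin 3 → ℝ,
      (∀ k, 0 ≤ lam k ∧ lam k ≤ w k) ∧ (∑ k, lam k = r) ∧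
      s = (1 / r) * ∑ k, lam k * g x k}) :
    h 0 = 0.725 ∧ h 1 = 0.725 ∧ (∀ x : Fin 2, h 1 ≤ h x) ∧
    (∀ k, g 0 k ≤ g 1 k) ∧ g 0 1 < g 1 1 := by
  subst hw hr
  have e0 : h 0 = 0.725 := by
    rw [hh]
    refine (isGreatest_rOWA_third_two_thirds (g 0) ?_ ?_).csSup_eq.trans ?_ <;>
      simp [hg0] <;> norm_num
  have e1 : h 1 = 0.725 := by
    rw [hh]
    refine (isGreatest_rOWA_third_two_thirds (g 1) ?_ ?_).csSup_eq.trans ?_ <;>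
      simp [hg1] <;> norm_num
  refine ⟨e0, e1, fun x => ?_, fun k => ?_, ?_⟩
  · fin_cases x
    · exact (e1.trans e0.symm).le
    · exact le_rfl
  · rw [hg0, hg1]
    fin_cases k <;> norm_num
  · norm_num [hg0, hg1]
end

section
/- Let X be a nonempty FINITE set, K ≥ 1, let g : X → (Fin K → ℝ), let w : Fin K → ℝ with w k ≥ 0 for all k and ∑_k w k = 1, let r ∈ (0,1], and define h(x) = max{ (1/r) ∑_k λ_k · g(x) k : 0 ≤ λ_k ≤ w k for all k, ∑_k λ_k = r }. If x* ∈ X is a minimizer of h over X, then there exists y* ∈ X such that y* is efficient for the multiobjective problem min_{x ∈ X} (g(x) 1, …, g(x) K) (no x ∈ X satisfies g(x) k ≤ g(y*) k for all k with strict inequality for some k) and h(y*) = h(x*). That is, an efficient alternative with the same scalarized value can always be found in a second phase. -/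
/-- Second phase: on a finite feasible set, from any minimizer of the r-OWA scalarization one
can find an efficient alternative with the same scalarized value. -/
theorem rOWA_second_phase_efficient
    {X : Type*} [Fintype X] [Nonempty X]
    (K : ℕ) (hK : 1 ≤ K) (g : X → Fin K → ℝ)
    (w : Fin K → ℝ) (hw0 : ∀ k, 0 ≤ w k) (hw1 : ∑ k, w k = 1)
    (r : ℝ) (hr0 : 0 < r) (hr1 : r ≤ 1)
    (h : X → ℝ)
    (hh : h = fun x => sSup {s : ℝ | ∃ lam : Fin K → ℝ,
      (∀ k, 0 ≤ lam k ∧ lam k ≤ w k) ∧ (∑ k, lam k = r) ∧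
      s = (1 / r) * ∑ k, lam k * g x k})
    (xstar : X) (hmin : ∀ x : X, h xstar ≤ h x) :
    ∃ ystar : X,
      (¬ ∃ x : X, (∀ k, g x k ≤ g ystar k) ∧ (∃ i, g x i < g ystar i)) ∧
      h ystar = h xstar := by
  have mono : ∀ x y : X, (∀ k, g x k ≤ g y k) → h x ≤ h y := by
    intro x y hxy
    rw [hh]
    apply csSup_le
    · refine ⟨_, fun k => r * w k, fun k => ⟨mul_nonneg hr0.le (hw0 k), ?_⟩, ?_, rfl⟩
      · exact mul_le_of_le_one_left (hw0 k) hr1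
      · rw [← Finset.mul_sum, hw1, mul_one]
    · rintro s ⟨lam, hlam, hsum, rfl⟩
      have hle : (1 / r) * ∑ k, lam k * g x k ≤ (1 / r) * ∑ k, lam k * g y k :=
        mul_le_mul_of_nonneg_left
          (Finset.sum_le_sum fun k _ => mul_le_mul_of_nonneg_left (hxy k) (hlam k).1)
          (by positivity)
      refine hle.trans (le_csSup ⟨(1 / r) * ∑ k, w k * |g y k|, ?_⟩ ⟨lam, hlam, hsum, rfl⟩)
      rintro s ⟨mu, hmu, -, rfl⟩
      refine mul_le_mul_of_nonneg_left (Finset.sum_le_sum fun k _ => ?_) (by positivity)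
      exact (mul_le_mul_of_nonneg_left (le_abs_self _) (hmu k).1).trans
        (mul_le_mul_of_nonneg_right (hmu k).2 (abs_nonneg _))
  obtain ⟨y, hy, hymin⟩ := Set.exists_min_image {x : X | ∀ k, g x k ≤ g xstar k}
    (fun x => ∑ k, g x k) (Set.toFinite _) ⟨xstar, fun k => le_rfl⟩
  refine ⟨y, ?_, le_antisymm (mono y xstar hy) (hmin y)⟩
  rintro ⟨x, hx, i, hi⟩
  have hlt : ∑ k, g x k < ∑ k, g y k :=
    Finset.sum_lt_sum (fun k _ => hx k) ⟨i, Finset.mem_univ i, hi⟩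
  exact (hymin x fun k => (hx k).trans (hy k)).not_gt hlt
end
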